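/- Let C be a projective 16-divisible binary linear code of effective length 131 and dimension 9, with weight distribution a_i and with a₃* the number of weight-3 vectors in the dual code C^⊥. Then a₁₆ = 0, a₃₂ = 0, a₄₈ = 1, a₆₄ = 457, a₈₀ = 53, and a₃* = 329. -/

import Mathlib

/-- Hamming weight of a binary vector. -/
def hwt {n : ℕ} (c : Fin n → ZMod 2) : ℕ :=
  (Finset.univ.filter fun i => c i ≠ 0).card

/-- The number of codewords of weight `i` in the code `C`. -/
noncomputable def weightCount {n : ℕ} (C : Submodule (ZMod 2) (Fin n → ZMod 2)) (i : ℕ) : ℕ :=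
  Set.ncard {c : Fin n → ZMod 2 | c ∈ C ∧ hwt c = i}

/-- The number of weight-`i` vectors in the dual code of `C`. -/
noncomputable def dualWeightCount {n : ℕ} (C : Submodule (ZMod 2) (Fin n → ZMod 2)) (i : ℕ) : ℕ :=
  Set.ncard {x : Fin n → ZMod 2 | (∀ c ∈ C, ∑ j, x j * c j = 0) ∧ hwt x = i}

def chi2 (x : ZMod 2) : ℤ := if x = 0 then 1 else -1

lemma chi2_add : ∀ x y : ZMod 2, chi2 (x + y) = chi2 x * chi2 y := by decide

lemma chi2_one : ∀ x : ZMod 2, x ≠ 0 → chi2 x = -1 := by decide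

lemma zmod2_ne : ∀ x y : ZMod 2, x ≠ y → x + y ≠ 0 := by decide

open Classical in
noncomputable def words {n : ℕ} (C : Submodule (ZMod 2) (Fin n → ZMod 2)) :
    Finset (Fin n → ZMod 2) := Finset.univ.filter (· ∈ C)

lemma mem_words {n : ℕ} {C : Submodule (ZMod 2) (Fin n → ZMod 2)} {c : Fin n → ZMod 2} :
    c ∈ words C ↔ c ∈ C := by simp [words]

lemma sum_chi_zero {n : ℕ} (C : Submodule (ZMod 2) (Fin n → ZMod 2))
    (f : (Fin n → ZMod 2) → ZMod 2) (hf : ∀ x y, f (x + y) = f x + f y)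
    (h : ∃ c ∈ C, f c ≠ 0) : ∑ c ∈ words C, chi2 (f c) = 0 := by
  obtain ⟨d, hd, hfd⟩ := h
  have h1 : ∑ c ∈ words C, chi2 (f c) = ∑ c ∈ words C, chi2 (f (c + d)) := by
    symm
    refine Finset.sum_bij (fun c _ => c + d) ?_ ?_ ?_ ?_
    · intro c hc
      exact mem_words.2 (C.add_mem (mem_words.1 hc) hd)
    · intro a _ b _ hab
      exact add_right_cancel hab
    · intro b hb
      exact ⟨b - d, mem_words.2 (C.sub_mem (mem_words.1 hb) hd), by simp⟩
    · intro c _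
      rfl
  have h2 : ∑ c ∈ words C, chi2 (f (c + d)) = - ∑ c ∈ words C, chi2 (f c) := by
    rw [← Finset.sum_neg_distrib]
    refine Finset.sum_congr rfl fun c _ => ?_
    rw [hf, chi2_add, chi2_one _ hfd]; ring
  omega

lemma sum_chi_card {n : ℕ} (C : Submodule (ZMod 2) (Fin n → ZMod 2))
    (f : (Fin n → ZMod 2) → ZMod 2)
    (h : ∀ c ∈ C, f c = 0) : ∑ c ∈ words C, chi2 (f c) = (words C).card := by
  rw [Finset.sum_congr rfl (g := fun _ => (1 : ℤ))]
  · simp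
  · intro c hc
    rw [h c (mem_words.1 hc)]; rfl

/-- The character sum over a coordinate set. -/
def chs {n : ℕ} (S : Finset (Fin n)) (c : Fin n → ZMod 2) : ℤ := ∑ i ∈ S, chi2 (c i)

lemma chs_eq {n : ℕ} (S : Finset (Fin n)) (c : Fin n → ZMod 2) :
    chs S c = S.card - 2 * (S.filter fun i => c i ≠ 0).card := by
  unfold chs
  have : ∀ i ∈ S, chi2 (c i) = 1 - 2 * (if c i ≠ 0 then 1 else 0) := by
    intro i _
    unfold chi2
    split_ifs <;> simp_all
  rw [Finset.sum_congr rfl this, Finset.sum_sub_distrib, ← Finset.mul_sum, Finset.sum_boole]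
  simp

lemma sum_chs {n : ℕ} (C : Submodule (ZMod 2) (Fin n → ZMod 2))
    (heff : ∀ i, ∃ c ∈ C, c i ≠ 0) (S : Finset (Fin n)) :
    ∑ c ∈ words C, chs S c = 0 := by
  unfold chs
  rw [Finset.sum_comm]
  exact Finset.sum_eq_zero fun i _ => sum_chi_zero C (fun c => c i) (fun _ _ => rfl) (heff i)

lemma sum_chs_sq {n : ℕ} (C : Submodule (ZMod 2) (Fin n → ZMod 2))
    (hproj : ∀ i j, i ≠ j → ∃ c ∈ C, c i ≠ c j) (S : Finset (Fin n)) :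
    ∑ c ∈ words C, chs S c ^ 2 = (words C).card * S.card := by
  have h1 : ∀ c ∈ words C, chs S c ^ 2 = ∑ i ∈ S, ∑ j ∈ S, chi2 (c i + c j) := by
    intro c _
    simp only [chs, chi2_add, sq, Finset.sum_mul_sum]
  rw [Finset.sum_congr rfl h1, Finset.sum_comm]
  have h2 : ∀ i ∈ S, ∑ c ∈ words C, ∑ j ∈ S, chi2 (c i + c j) = ((words C).card : ℤ) := by
    intro i hi
    rw [Finset.sum_comm, Finset.sum_eq_single i]
    · exact sum_chi_card C (fun c => c i + c i) (fun c _ => CharTwo.add_self_eq_zero _)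
    · intro j _ hj
      refine sum_chi_zero C (fun c => c i + c j) (fun x y => ?_) ?_
      · simp only [Pi.add_apply]; ring
      · obtain ⟨c, hc, h⟩ := hproj i j hj.symm
        exact ⟨c, hc, zmod2_ne _ _ h⟩
    · exact fun h => absurd hi h
  rw [Finset.sum_congr rfl h2]
  simp [mul_comm]

open Classical in
noncomputable def trip {n : ℕ} (C : Submodule (ZMod 2) (Fin n → ZMod 2)) :
    Finset (Fin n × Fin n × Fin n) :=
  Finset.univ.filter fun p => ∀ c ∈ C, c p.1 + c p.2.1 + c p.2.2 = 0

lemma sum_chs_cube {n : ℕ} (C : Submodule (ZMod 2) (Fin n → ZMod 2)) :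
    ∑ c ∈ words C, chs Finset.univ c ^ 3 = (words C).card * (trip C).card := by
  classical
  have h1 : ∀ c ∈ words C, chs Finset.univ c ^ 3 =
      ∑ p : Fin n × Fin n × Fin n, chi2 (c p.1 + c p.2.1 + c p.2.2) := by
    intro c _
    simp only [chs, chi2_add, Fintype.sum_prod_type, pow_succ, pow_zero, one_mul,
      Finset.sum_mul, Finset.mul_sum]
    rw [Finset.sum_comm]
    refine (Finset.sum_congr rfl fun _ _ => Finset.sum_comm).trans ?_
    rw [Finset.sum_comm]
  rw [Finset.sum_congr rfl h1, Finset.sum_comm]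
  have h2 : ∀ p : Fin n × Fin n × Fin n,
      ∑ c ∈ words C, chi2 (c p.1 + c p.2.1 + c p.2.2) =
      if p ∈ trip C then ((words C).card : ℤ) else 0 := by
    intro p
    split_ifs with h
    · simp only [trip, Finset.mem_filter, Finset.mem_univ, true_and] at h
      exact sum_chi_card C (fun c => c p.1 + c p.2.1 + c p.2.2) h
    · simp only [trip, Finset.mem_filter, Finset.mem_univ, true_and] at h
      push Not at h
      refine sum_chi_zero C (fun c => c p.1 + c p.2.1 + c p.2.2) (fun x y => ?_) h
      simp only [Pi.add_apply]; ring
  rw [Finset.sum_congr rfl fun p _ => h2 p]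
  simp [mul_comm]

lemma trip_distinct {n : ℕ} (C : Submodule (ZMod 2) (Fin n → ZMod 2))
    (heff : ∀ i, ∃ c ∈ C, c i ≠ 0) (p : Fin n × Fin n × Fin n) (hp : p ∈ trip C) :
    p.1 ≠ p.2.1 ∧ p.1 ≠ p.2.2 ∧ p.2.1 ≠ p.2.2 := by
  simp only [trip, Finset.mem_filter, Finset.mem_univ, true_and] at hp
  obtain ⟨i, j, l⟩ := p
  simp only at hp ⊢
  have key : ∀ x y : ZMod 2, y ≠ 0 → x + x + y ≠ 0 ∧ x + y + x ≠ 0 ∧ y + x + x ≠ 0 := by decide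
  refine ⟨?_, ?_, ?_⟩
  · rintro rfl
    obtain ⟨c, hc, h⟩ := heff l
    exact (key _ _ h).1 (hp c hc)
  · rintro rfl
    obtain ⟨c, hc, h⟩ := heff j
    exact (key _ _ h).2.1 (hp c hc)
  · rintro rfl
    obtain ⟨c, hc, h⟩ := heff i
    exact (key _ _ h).2.2 (hp c hc)

open Classical in
noncomputable def dtrip {n : ℕ} (C : Submodule (ZMod 2) (Fin n → ZMod 2)) :
    Finset (Finset (Fin n)) :=
  Finset.univ.filter fun s => s.card = 3 ∧ ∀ c ∈ C, ∑ j ∈ s, c j = 0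

lemma dual_eq {n : ℕ} (C : Submodule (ZMod 2) (Fin n → ZMod 2)) :
    dualWeightCount C 3 = (dtrip C).card := by
  classical
  unfold dualWeightCount
  rw [← Set.ncard_coe_finset]
  have key : ∀ x : ZMod 2, ∀ y : ZMod 2, x * y = if x ≠ 0 then y else 0 := by decide
  have hs : ∀ x c : Fin n → ZMod 2,
      ∑ j, x j * c j = ∑ j ∈ Finset.univ.filter (fun i => x i ≠ 0), c j := by
    intro x c
    rw [Finset.sum_filter]
    exact Finset.sum_congr rfl fun j _ => key _ _
  refine Set.ncard_congr (fun x _ => Finset.univ.filter (fun i => x i ≠ 0)) ?_ ?_ ?_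
  · rintro x ⟨h1, h2⟩
    simp only [dtrip, Finset.coe_filter, Finset.mem_univ, true_and, Set.mem_ofPred_eq]
    exact ⟨h2, fun c hc => by rw [← hs]; exact h1 c hc⟩
  · intro x y _ _ h
    funext i
    have h' := Finset.ext_iff.1 h i
    simp only [Finset.mem_filter, Finset.mem_univ, true_and] at h'
    revert h'
    generalize x i = a
    generalize y i = b
    revert a b
    decide
  · intro s h
    simp only [dtrip, Finset.coe_filter, Finset.mem_univ, true_and, Set.mem_ofPred_eq] at h
    have hf : Finset.univ.filter (fun i => (if i ∈ s then (1 : ZMod 2) else 0) ≠ 0) = s := by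
      ext i; simp
    refine ⟨fun i => if i ∈ s then 1 else 0, ⟨?_, ?_⟩, hf⟩
    · intro c hc
      rw [hs, hf]
      exact h.2 c hc
    · unfold hwt
      rw [hf]; exact h.1

lemma trip_card {n : ℕ} (C : Submodule (ZMod 2) (Fin n → ZMod 2))
    (heff : ∀ i, ∃ c ∈ C, c i ≠ 0) : (trip C).card = 6 * (dtrip C).card := by
  classical
  have hsum : ∀ i j l : Fin n, i ≠ j → i ≠ l → j ≠ l → ∀ c : Fin n → ZMod 2,
      ∑ x ∈ ({i, j, l} : Finset (Fin n)), c x = c i + c j + c l := by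
    intro i j l h1 h2 h3 c
    rw [Finset.sum_insert (by simp [h1, h2]), Finset.sum_pair h3]; ring
  rw [Finset.card_eq_sum_card_fiberwise (f := fun p => ({p.1, p.2.1, p.2.2} : Finset (Fin n)))
    (t := dtrip C)]
  · rw [Finset.sum_congr rfl (g := fun _ => 6)]
    · simp [mul_comm]
    intro s hs
    simp only [dtrip, Finset.mem_filter, Finset.mem_univ, true_and] at hs
    obtain ⟨hs3, hs0⟩ := hs
    obtain ⟨a, b, d, hab, had, hbd, rfl⟩ := Finset.card_eq_three.1 hs3
    have : (trip C).filter (fun p => ({p.1, p.2.1, p.2.2} : Finset (Fin n)) = {a, b, d}) =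
        {(a, b, d), (a, d, b), (b, a, d), (b, d, a), (d, a, b), (d, b, a)} := by
      ext p
      constructor
      · intro hp
        rw [Finset.mem_filter] at hp
        obtain ⟨h1, h2, h3⟩ := trip_distinct C heff p hp.1
        obtain ⟨i, j, l⟩ := p
        simp only at h1 h2 h3 hp
        have hi : i ∈ ({a, b, d} : Finset (Fin n)) := by rw [← hp.2]; simp
        have hj : j ∈ ({a, b, d} : Finset (Fin n)) := by rw [← hp.2]; simp
        have hl : l ∈ ({a, b, d} : Finset (Fin n)) := by rw [← hp.2]; simp
        simp only [Finset.mem_insert, Finset.mem_singleton, Prod.mk.injEq] at hi hj hl ⊢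
        grind
      · intro hp
        have h0 : ∀ c ∈ C, c a + c b + c d = 0 := fun c hc => by
          rw [← hsum a b d hab had hbd]; exact hs0 c hc
        rw [Finset.mem_filter]
        simp only [Finset.mem_insert, Finset.mem_singleton] at hp
        simp only [trip, Finset.mem_filter, Finset.mem_univ, true_and]
        rcases hp with rfl | rfl | rfl | rfl | rfl | rfl
        all_goals
          refine ⟨fun c hc => by linear_combination h0 c hc, ?_⟩
          ext x; simp only [Finset.mem_insert, Finset.mem_singleton]; try tauto
    rw [this]
    have e1 := hab.symm
    have e2 := had.symm
    have e3 := hbd.symm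
    simp [Finset.card_insert_of_notMem, *]
  · intro p hp
    obtain ⟨h1, h2, h3⟩ := trip_distinct C heff p hp
    simp only [trip, Finset.coe_filter, Finset.mem_univ, true_and, Set.mem_ofPred_eq] at hp
    simp only [dtrip, Finset.coe_filter, Finset.mem_univ, true_and, Set.mem_ofPred_eq]
    refine ⟨Finset.card_eq_three.2 ⟨_, _, _, h1, h2, h3, rfl⟩, fun c hc => ?_⟩
    rw [hsum _ _ _ h1 h2 h3]; exact hp c hc

lemma words_card {n k : ℕ} (C : Submodule (ZMod 2) (Fin n → ZMod 2))
    (hk : Module.finrank (ZMod 2) C = k) : (words C).card = 2 ^ k := by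
  classical
  have h := Module.card_eq_pow_finrank (K := ZMod 2) (V := C)
  rw [hk, ZMod.card] at h
  rw [← h, words, Fintype.card_subtype]

lemma wc_eq {n : ℕ} (C : Submodule (ZMod 2) (Fin n → ZMod 2)) (i : ℕ) :
    weightCount C i = ((words C).filter fun c => hwt c = i).card := by
  unfold weightCount
  rw [← Set.ncard_coe_finset]
  congr 1
  ext c
  simp [mem_words]

lemma no96 (n : ℕ) (hn : n = 131) (C : Submodule (ZMod 2) (Fin n → ZMod 2))
    (hk : Module.finrank (ZMod 2) C = 9)
    (heff : ∀ i : Fin n, ∃ c ∈ C, c i ≠ 0)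
    (hproj : ∀ i j : Fin n, i ≠ j → ∃ c ∈ C, c i ≠ c j)
    (hdiv : ∀ c ∈ C, 16 ∣ hwt c) (d : Fin n → ZMod 2) (hd : d ∈ C) : hwt d ≠ 96 := by
  intro h96
  set Z : Finset (Fin n) := Finset.univ.filter fun i => d i = 0 with hZ
  have hZc : Z.card = 35 := by
    have := Finset.card_filter_add_card_filter_not (s := (Finset.univ : Finset (Fin n)))
      (fun i => d i = 0)
    simp only [Finset.card_univ, Fintype.card_fin] at this
    unfold hwt at h96
    simp only [ne_eq] at h96
    rw [h96, ← hZ] at this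
    omega
  have s0 := words_card C hk
  have s1 := sum_chs C heff Z
  have s2 := sum_chs_sq C hproj Z
  have hz : ∀ c ∈ C, 8 ∣ (Z.filter fun i => c i ≠ 0).card := by
    intro c hc
    have e : hwt c + hwt (c + d) = 96 + 2 * (Z.filter fun i => c i ≠ 0).card := by
      rw [← h96]
      simp only [hwt, hZ, Finset.filter_filter, Finset.card_filter, Finset.mul_sum,
        ← Finset.sum_add_distrib]
      refine Finset.sum_congr rfl fun i _ => ?_
      rw [Pi.add_apply]
      generalize c i = x
      generalize d i = y
      revert x y
      decide
    have h1 := hdiv c hc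
    have h2 := hdiv _ (C.add_mem hc hd)
    omega
  have hpos : 0 ≤ ∑ c ∈ words C, (chs Z c ^ 2 + 10 * chs Z c - 39) := by
    refine Finset.sum_nonneg fun c hc => ?_
    rw [chs_eq, hZc]
    obtain ⟨u, hu⟩ := hz c (mem_words.1 hc)
    rw [hu]
    push_cast
    rcases le_or_gt u 2 with h | h
    · have : (u : ℤ) ≤ 2 := by exact_mod_cast h
      nlinarith
    · have : (3 : ℤ) ≤ u := by exact_mod_cast h
      nlinarith
  rw [Finset.sum_sub_distrib, Finset.sum_add_distrib, ← Finset.mul_sum, s1, s2] at hpos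
  simp [s0, hZc] at hpos

lemma wd_aux (n : ℕ) (hn : n = 131) (C : Submodule (ZMod 2) (Fin n → ZMod 2))
    (hk : Module.finrank (ZMod 2) C = 9)
    (heff : ∀ i : Fin n, ∃ c ∈ C, c i ≠ 0)
    (hproj : ∀ i j : Fin n, i ≠ j → ∃ c ∈ C, c i ≠ c j)
    (hdiv : ∀ c ∈ C, 16 ∣ hwt c) :
    weightCount C 16 = 0 ∧ weightCount C 32 = 0 ∧ weightCount C 48 = 1 ∧
    weightCount C 64 = 457 ∧ weightCount C 80 = 53 ∧ dualWeightCount C 3 = 329 := by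
  have s0 := words_card C hk
  have s1 := sum_chs C heff Finset.univ
  have s2 := sum_chs_sq C hproj Finset.univ
  have s3 := sum_chs_cube C
  rw [trip_card C heff, ← dual_eq] at s3
  have w0 : weightCount C 0 = 1 := by
    unfold weightCount
    rw [Set.ncard_eq_one]
    refine ⟨0, ?_⟩
    ext c
    simp only [Set.mem_ofPred_eq, Set.mem_singleton_iff]
    constructor
    · rintro ⟨_, h⟩
      unfold hwt at h
      rw [Finset.card_eq_zero] at h
      funext i
      by_contra hi
      have : i ∈ Finset.univ.filter fun i => c i ≠ 0 := by simpa using hi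
      rw [h] at this
      simp at this
    · rintro rfl
      exact ⟨C.zero_mem, by simp [hwt]⟩
  have w96 : weightCount C 96 = 0 := by
    rw [wc_eq, Finset.card_eq_zero, Finset.filter_eq_empty_iff]
    exact fun {c} hc => no96 n hn C hk heff hproj hdiv c (mem_words.1 hc)
  have hF : ∀ F : ℤ → ℤ, ∑ c ∈ words C, F (chs Finset.univ c) =
      ∑ t ∈ Finset.range 9, (weightCount C (16 * t) : ℤ) * F (131 - 32 * t) := by
    intro F
    rw [← Finset.sum_fiberwise_of_maps_to (s := words C) (t := Finset.range 9)
      (g := fun c => hwt c / 16)]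
    · refine Finset.sum_congr rfl fun t _ => ?_
      have hfil : (words C).filter (fun c => hwt c / 16 = t) =
          (words C).filter (fun c => hwt c = 16 * t) := by
        refine Finset.filter_congr fun c hc => ?_
        have := hdiv c (mem_words.1 hc)
        omega
      rw [hfil, wc_eq, Finset.sum_congr rfl (g := fun _ => F (131 - 32 * t))]
      · simp
      · intro c hc
        have h := (Finset.mem_filter.1 hc).2
        rw [chs_eq]
        unfold hwt at h
        rw [h]
        congr 1
        simp only [Finset.card_univ, Fintype.card_fin, hn]
        push_cast
        ring
    · intro c _
      have : hwt c ≤ 131 := by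
        unfold hwt
        exact (Finset.card_le_univ _).trans (by simp [hn])
      rw [Finset.mem_range]
      omega
  have f0 := hF (fun _ => 1)
  have f1 := hF (fun x => x)
  have f2 := hF (fun x => x ^ 2)
  have f3 := hF (fun x => x ^ 3)
  rw [s1] at f1
  rw [s2] at f2
  rw [s3] at f3
  simp only [Finset.sum_const, s0, Finset.sum_range_succ, Finset.sum_range_zero, Finset.card_univ,
    Fintype.card_fin, hn] at f0 f1 f2 f3
  norm_num [w0, w96] at f0 f1 f2 f3
  omega

/-- Weight distribution of a (hypothetical) projective 16-divisible `[131, 9]` code. -/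
theorem weight_distribution_dim_9 (C : Submodule (ZMod 2) (Fin 131 → ZMod 2))
    (hk : Module.finrank (ZMod 2) C = 9)
    (heff : ∀ i : Fin 131, ∃ c ∈ C, c i ≠ 0)
    (hproj : ∀ i j : Fin 131, i ≠ j → ∃ c ∈ C, c i ≠ c j)
    (hdiv : ∀ c ∈ C, 16 ∣ hwt c) :
    weightCount C 16 = 0 ∧ weightCount C 32 = 0 ∧ weightCount C 48 = 1 ∧
    weightCount C 64 = 457 ∧ weightCount C 80 = 53 ∧ dualWeightCount C 3 = 329 := by
  exact wd_aux 131 rfl C hk heff hproj hdiv
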